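/- Fix k ∈ ℕ with k ≥ 1, n₁, n₂ ∈ (0,1) with n₁ + n₂ = 1, and C > 0. There exists c_k > 0, depending only on k, n₁, n₂ and C, with the following property. For every N ∈ ℕ with N ≥ 2 and every N₁, N₂ ∈ ℕ with N₁ + N₂ = N, |N₁/N − n₁| ≤ C/N and |N₂/N − n₂| ≤ C/N, one has Σ_{j=0}^{k} | binom(N₁,k−j)·binom(N₂,j)/binom(N,k) − binom(k,j)·n₁^{k−j}·n₂^{j} | ≤ c_k / N. Consequently the Hermitian matrix γ^{(k)} − γ_∞^{(k)} indexed by (Fin k → Fin 2), where γ^{(k)}(σ,τ) = Σ_{j=0}^{k} (binom(N₁,k−j)binom(N₂,j)/binom(N,k))·v_{k,j}(σ)·conj(v_{k,j}(τ)) and γ_∞^{(k)}(σ,τ) = Σ_{j=0}^{k} binom(k,j)n₁^{k−j}n₂^{j}·v_{k,j}(σ)·conj(v_{k,j}(τ)), has the sum of the absolute values of its eigenvalues at most c_k / N. -/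

import Mathlib

open scoped BigOperators
open ComplexConjugate

noncomputable section

/-- Number of indices `i` with `σ i = 1`. -/
def cnt {m : ℕ} (σ : Fin m → Fin 2) : ℕ :=
  (Finset.univ.filter fun i => σ i = 1).card

/-- Coordinate vector of the normalized symmetric tensor `e₁^{⊗(k−j)} ∨ e₂^{⊗j}`. -/
def vkj (k j : ℕ) (σ : Fin k → Fin 2) : ℂ :=
  if cnt σ = j then (((Real.sqrt (Nat.choose k j))⁻¹ : ℝ) : ℂ) else 0

/-- The difference matrix `γ^{(k)} − γ_∞^{(k)}`. -/
def Dmat (k N N₁ N₂ : ℕ) (n₁ n₂ : ℝ) : Matrix (Fin k → Fin 2) (Fin k → Fin 2) ℂ :=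
  Matrix.of fun σ τ =>
    ∑ j ∈ Finset.range (k + 1),
      (((((N₁.choose (k - j) : ℝ) * (N₂.choose j : ℝ)) / (N.choose k : ℝ)
          - (k.choose j : ℝ) * n₁ ^ (k - j) * n₂ ^ j : ℝ)) : ℂ)
        * vkj k j σ * conj (vkj k j τ)

open Finset in
lemma card_filter_cnt_eq (k j : ℕ) :
    #{σ : Fin k → Fin 2 | cnt σ = j} = k.choose j := by
  trans #(powersetCard j (univ : Finset (Fin k)))
  swap
  · rw [card_powersetCard, card_univ, Fintype.card_fin]
  refine card_nbij' (fun σ => univ.filter fun i => σ i = 1) (fun s i => if i ∈ s then 1 else 0)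
    ?_ ?_ ?_ ?_
  · intro σ hσ
    exact mem_powersetCard.2 ⟨subset_univ _, (mem_filter.1 hσ).2⟩
  · intro s hs
    refine mem_filter.2 ⟨mem_univ _, ?_⟩
    simpa [cnt] using (mem_powersetCard.1 hs).2
  · intro σ _
    funext i
    by_cases h : σ i = 1
    · simp [h]
    · simp only [mem_filter, mem_univ, true_and, h, if_false]
      omega
  · intro s _
    ext i
    simp

lemma sum_norm_sq_vkj {k j : ℕ} (hj : j ≤ k) : ∑ σ, ‖vkj k j σ‖ ^ 2 = 1 := by
  have hpos : (0 : ℝ) < k.choose j := by exact_mod_cast Nat.choose_pos hj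
  have h (σ : Fin k → Fin 2) :
      ‖vkj k j σ‖ ^ 2 = if cnt σ = j then (k.choose j : ℝ)⁻¹ else 0 := by
    unfold vkj
    split_ifs
    · rw [Complex.norm_real, Real.norm_eq_abs, sq_abs, inv_pow, Real.sq_sqrt hpos.le]
    · simp
  simp_rw [h]
  rw [← Finset.sum_filter, Finset.sum_const, card_filter_cnt_eq, nsmul_eq_mul,
    mul_inv_cancel₀ hpos.ne']

/-- The trace norm of `∑ j, d j • v j (v j)ᴴ` is at most `∑ j, |d j| ‖v j‖²`. -/
lemma sum_abs_eigenvalues_le {n ι : Type*} [Fintype n] [DecidableEq n] {A : Matrix n n ℂ}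
    (hA : A.IsHermitian) (s : Finset ι) (d : ι → ℝ) (v : ι → n → ℂ)
    (h : A = ∑ j ∈ s, (d j : ℂ) • Matrix.vecMulVec (v j) (star (v j))) :
    ∑ i, |hA.eigenvalues i| ≤ ∑ j ∈ s, |d j| * ∑ σ, ‖v j σ‖ ^ 2 := by
  set u := hA.eigenvectorBasis
  have key (i : n) : hA.eigenvalues i =
      ∑ j ∈ s, d j * ‖inner ℂ (u i) (WithLp.toLp 2 (v j))‖ ^ 2 := by
    have hmul : A.mulVec (u i).ofLp = (∑ j ∈ s, (d j : ℂ) • Matrix.vecMulVec (v j)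
        (star (v j))).mulVec (u i).ofLp := by rw [← h]
    rw [hA.eigenvalues_eq i, hmul, Matrix.sum_mulVec, dotProduct_sum, map_sum]
    refine Finset.sum_congr rfl fun j _ => ?_
    have hin : inner ℂ (u i) (WithLp.toLp 2 (v j)) = star (u i).ofLp ⬝ᵥ v j := by
      rw [EuclideanSpace.inner_eq_star_dotProduct, dotProduct_comm]
    have hconj : star (v j) ⬝ᵥ (u i).ofLp = star (star (u i).ofLp ⬝ᵥ v j) := by
      rw [Matrix.star_dotProduct]
    rw [hin, Matrix.smul_mulVec, Matrix.vecMulVec_mulVec, dotProduct_smul, hconj,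
      dotProduct_smul]
    change RCLike.re ((d j : ℂ) * ((star (u i).ofLp ⬝ᵥ v j) * star (star (u i).ofLp ⬝ᵥ v j))) = _
    rw [Complex.star_def, Complex.mul_conj, Complex.normSq_eq_norm_sq,
      ← Complex.ofReal_mul]
    rfl
  calc ∑ i, |hA.eigenvalues i|
      ≤ ∑ i, ∑ j ∈ s, |d j| * ‖inner ℂ (u i) (WithLp.toLp 2 (v j))‖ ^ 2 := by
        refine Finset.sum_le_sum fun i _ => ?_
        rw [key]
        refine (Finset.abs_sum_le_sum_abs _ _).trans_eq (Finset.sum_congr rfl fun j _ => ?_)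
        rw [abs_mul, abs_of_nonneg (sq_nonneg ‖_‖)]
    _ = ∑ j ∈ s, |d j| * ∑ σ, ‖v j σ‖ ^ 2 := by
        rw [Finset.sum_comm]
        refine Finset.sum_congr rfl fun j _ => ?_
        rw [← Finset.mul_sum, u.sum_sq_norm_inner_right, EuclideanSpace.norm_sq_eq]

lemma abs_mul_sub_mul_le {x y x' y' : ℝ} (hx : |x| ≤ 1) (hy' : |y'| ≤ 1) :
    |x * y - x' * y'| ≤ |x - x'| + |y - y'| := by
  calc |x * y - x' * y'| = |x * (y - y') + (x - x') * y'| := by ring_nf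
    _ ≤ |x| * |y - y'| + |x - x'| * |y'| := by
        rw [← abs_mul, ← abs_mul]
        exact abs_add_le _ _
    _ ≤ 1 * |y - y'| + |x - x'| * 1 := by gcongr
    _ = _ := by ring

lemma descFactorial_div_pow_le_one {M N : ℕ} (hM : M ≤ N) (a : ℕ) :
    (M.descFactorial a : ℝ) / N ^ a ≤ 1 := by
  refine div_le_one_of_le₀ ?_ (by positivity)
  exact_mod_cast (M.descFactorial_le_pow a).trans (Nat.pow_le_pow_left hM a)

lemma abs_descFactorial_div_pow_sub_pow_le {M N : ℕ} (hM : M ≤ N) {p C : ℝ} (hp0 : 0 ≤ p)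
    (hp1 : p ≤ 1) (h : |(M : ℝ) / N - p| ≤ C / N) (a : ℕ) :
    |(M.descFactorial a : ℝ) / N ^ a - p ^ a| ≤ a * (C + a) / N := by
  induction a with
  | zero => simp
  | succ a ih =>
    have hN : (0 : ℝ) ≤ N := N.cast_nonneg
    have hsub : |((M - a : ℕ) : ℝ) - M| ≤ a := by
      have h1 : (M - a : ℕ) ≤ M := Nat.sub_le M a
      have h2 : M ≤ (M - a : ℕ) + a := by omega
      have h1' : ((M - a : ℕ) : ℝ) ≤ M := by exact_mod_cast h1
      have h2' : (M : ℝ) ≤ (M - a : ℕ) + a := by exact_mod_cast h2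
      rw [abs_le]
      constructor <;> linarith [(Nat.cast_nonneg a : (0 : ℝ) ≤ a)]
    have hfac : |((M - a : ℕ) : ℝ) / N - p| ≤ (C + a) / N := by
      calc |((M - a : ℕ) : ℝ) / N - p|
          = |(((M - a : ℕ) : ℝ) - M) / N + ((M : ℝ) / N - p)| := by ring_nf
        _ ≤ |((M - a : ℕ) : ℝ) - M| / N + |(M : ℝ) / N - p| := by
            refine (abs_add_le _ _).trans_eq ?_
            rw [abs_div, abs_of_nonneg hN]
        _ ≤ a / N + C / N := by gcongr
        _ = (C + a) / N := by ring
    have hx : |((M - a : ℕ) : ℝ) / N| ≤ 1 := by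
      rw [abs_of_nonneg (by positivity)]
      refine div_le_one_of_le₀ ?_ hN
      exact_mod_cast (Nat.sub_le M a).trans hM
    have hy : |p ^ a| ≤ 1 := by
      rw [abs_of_nonneg (by positivity)]
      exact pow_le_one₀ hp0 hp1
    calc |(M.descFactorial (a + 1) : ℝ) / N ^ (a + 1) - p ^ (a + 1)|
        = |((M - a : ℕ) : ℝ) / N * ((M.descFactorial a : ℝ) / N ^ a) - p * p ^ a| := by
          rw [Nat.descFactorial_succ, Nat.cast_mul, pow_succ', pow_succ', mul_div_mul_comm]
      _ ≤ (C + a) / N + a * (C + a) / N :=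
          (abs_mul_sub_mul_le hx hy).trans (add_le_add hfac ih)
      _ = (a + 1) * (C + a) / N := by ring
      _ ≤ ((a + 1 : ℕ) : ℝ) * (C + (a + 1 : ℕ)) / N := by
          push_cast
          gcongr
          linarith

lemma choose_mul_choose_le {N₁ N₂ a b : ℕ} :
    N₁.choose a * N₂.choose b ≤ (N₁ + N₂).choose (a + b) := by
  rw [Nat.add_choose_eq]
  exact Finset.single_le_sum (f := fun ij : ℕ × ℕ => N₁.choose ij.1 * N₂.choose ij.2)
    (fun _ _ => Nat.zero_le _) (Finset.HasAntidiagonal.mem_antidiagonal.2 (rfl : (a, b).1 + (a, b).2 = a + b))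

/-- Quantitative convergence of the hypergeometric to the binomial distribution. -/
lemma abs_hypergeometric_sub_binomial_le {N₁ N₂ a b : ℕ} {p q C : ℝ} (hN : 0 < N₁ + N₂)
    (hp0 : 0 ≤ p) (hp1 : p ≤ 1) (hq0 : 0 ≤ q) (hq1 : q ≤ 1)
    (h₁ : |(N₁ : ℝ) / (N₁ + N₂ : ℕ) - p| ≤ C / (N₁ + N₂ : ℕ))
    (h₂ : |(N₂ : ℝ) / (N₁ + N₂ : ℕ) - q| ≤ C / (N₁ + N₂ : ℕ)) :
    |(N₁.choose a * N₂.choose b : ℝ) / (N₁ + N₂).choose (a + b) -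
        (a + b).choose b * p ^ a * q ^ b| ≤
      ((a + b : ℕ) * (a + b : ℕ) + (a + b).choose b * (a * (C + a) + b * (C + b))) /
        (N₁ + N₂ : ℕ) := by
  set N := N₁ + N₂
  set k := a + b
  have hNpos : (0 : ℝ) < N := by exact_mod_cast hN
  set T : ℝ := (N₁.choose a * N₂.choose b : ℝ) / N.choose k
  set Y : ℝ := (N.descFactorial k : ℝ) / N ^ k
  set X₁ : ℝ := (N₁.descFactorial a : ℝ) / N ^ a
  set X₂ : ℝ := (N₂.descFactorial b : ℝ) / N ^ b
  have hle : (N₁.choose a * N₂.choose b : ℝ) ≤ N.choose k := by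
    exact_mod_cast choose_mul_choose_le
  have hT0 : 0 ≤ T := by positivity
  have hT1 : T ≤ 1 := div_le_one_of_le₀ hle (by positivity)
  have hTmul : T * N.choose k = N₁.choose a * N₂.choose b := by
    refine div_mul_cancel_of_imp fun h0 => le_antisymm (h0 ▸ hle) (by positivity)
  have hfact : (k.choose b : ℝ) * (a.factorial * b.factorial) = k.factorial := by
    have := Nat.choose_mul_factorial_mul_factorial (Nat.le_add_left b a)
    rw [Nat.add_sub_cancel] at this
    rw [← this]
    push_cast
    ring
  have hTY : T * Y = k.choose b * (X₁ * X₂) := by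
    simp only [Y, X₁, X₂, Nat.descFactorial_eq_factorial_mul_choose, Nat.cast_mul]
    have hpow : (N : ℝ) ^ k = N ^ a * N ^ b := pow_add _ _ _
    rw [hpow, ← hfact]
    clear_value T
    linear_combination
      (k.choose b * a.factorial * b.factorial / (N ^ a * N ^ b : ℝ)) * hTmul
  have hY : |1 - Y| ≤ (k : ℝ) * k / N := by
    have := abs_descFactorial_div_pow_sub_pow_le (le_refl N) (p := 1) (C := 0) zero_le_one le_rfl
      (by simp [div_self hNpos.ne']) k
    rwa [one_pow, zero_add, abs_sub_comm] at this
  have hX₁ : |X₁| ≤ 1 := by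
    rw [abs_of_nonneg (by positivity)]
    exact descFactorial_div_pow_le_one (Nat.le_add_right _ _) a
  have hq : |q ^ b| ≤ 1 := by
    rw [abs_of_nonneg (by positivity)]
    exact pow_le_one₀ hq0 hq1
  have hX : |X₁ * X₂ - p ^ a * q ^ b| ≤ a * (C + a) / N + b * (C + b) / N :=
    (abs_mul_sub_mul_le hX₁ hq).trans <| add_le_add
      (abs_descFactorial_div_pow_sub_pow_le (Nat.le_add_right _ _) hp0 hp1 h₁ a)
      (abs_descFactorial_div_pow_sub_pow_le (Nat.le_add_left _ _) hq0 hq1 h₂ b)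
  calc |T - k.choose b * p ^ a * q ^ b|
      = |T * (1 - Y) + k.choose b * (X₁ * X₂ - p ^ a * q ^ b)| := by
        congr 1
        linear_combination hTY
    _ ≤ T * |1 - Y| + k.choose b * |X₁ * X₂ - p ^ a * q ^ b| := by
        refine (abs_add_le _ _).trans_eq ?_
        rw [abs_mul, abs_mul, abs_of_nonneg hT0, Nat.abs_cast]
    _ ≤ 1 * ((k : ℝ) * k / N) + k.choose b * (a * (C + a) / N + b * (C + b) / N) := by
        gcongr
    _ = _ := by ring

lemma Dmat_eq_sum (k N N₁ N₂ : ℕ) (n₁ n₂ : ℝ) :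
    Dmat k N N₁ N₂ n₁ n₂ = ∑ j ∈ Finset.range (k + 1),
      (((N₁.choose (k - j) : ℝ) * (N₂.choose j : ℝ) / (N.choose k : ℝ)
          - (k.choose j : ℝ) * n₁ ^ (k - j) * n₂ ^ j : ℝ) : ℂ) •
        Matrix.vecMulVec (vkj k j) (star (vkj k j)) := by
  ext σ τ
  simp [Dmat, Matrix.sum_apply, Matrix.vecMulVec_apply, mul_assoc]

lemma isHermitian_Dmat (k N N₁ N₂ : ℕ) (n₁ n₂ : ℝ) :
    (Dmat k N N₁ N₂ n₁ n₂).IsHermitian := by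
  ext σ τ
  simp only [Dmat, Matrix.conjTranspose_apply, Matrix.of_apply, star_sum, star_mul',
    Complex.star_def, Complex.conj_ofReal, Complex.conj_conj]
  exact Finset.sum_congr rfl fun j _ => by ring

/-- with `|N₁/N − n₁| ≤ C/N` and `|N₂/N − n₂| ≤ C/N`, both the ℓ¹ bound
on the coefficients and the trace-norm bound on `γ^{(k)} − γ_∞^{(k)}` hold with
constant `c_k / N`. -/
theorem stmt10 (k : ℕ) (hk : 1 ≤ k) (n₁ n₂ : ℝ)
    (h₁ : n₁ ∈ Set.Ioo (0 : ℝ) 1) (h₂ : n₂ ∈ Set.Ioo (0 : ℝ) 1) (hsum : n₁ + n₂ = 1)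
    (C : ℝ) (hC : 0 < C) :
    ∃ c : ℝ, 0 < c ∧
      ∀ N N₁ N₂ : ℕ, 2 ≤ N → N₁ + N₂ = N →
        |(N₁ : ℝ) / N - n₁| ≤ C / N → |(N₂ : ℝ) / N - n₂| ≤ C / N →
        ((∑ j ∈ Finset.range (k + 1),
            |((N₁.choose (k - j) : ℝ) * (N₂.choose j : ℝ)) / (N.choose k : ℝ)
              - (k.choose j : ℝ) * n₁ ^ (k - j) * n₂ ^ j|) ≤ c / N)
        ∧ ∃ hD : (Dmat k N N₁ N₂ n₁ n₂).IsHermitian,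
            (∑ i : Fin k → Fin 2, |hD.eigenvalues i|) ≤ c / N := by
  set B : ℕ → ℝ := fun j => (k : ℝ) * k +
    k.choose j * ((k - j : ℕ) * (C + (k - j : ℕ)) + j * (C + j))
  have hB (j : ℕ) : 0 < B j := by
    have : (1 : ℝ) ≤ k := by exact_mod_cast hk
    positivity
  refine ⟨∑ j ∈ Finset.range (k + 1), B j, Finset.sum_pos (fun j _ => hB j) (by simp), ?_⟩
  rintro N N₁ N₂ hN rfl hN₁ hN₂
  have hcoeff : (∑ j ∈ Finset.range (k + 1),
      |((N₁.choose (k - j) : ℝ) * (N₂.choose j : ℝ)) / ((N₁ + N₂).choose k : ℝ)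
        - (k.choose j : ℝ) * n₁ ^ (k - j) * n₂ ^ j|) ≤
      (∑ j ∈ Finset.range (k + 1), B j) / (N₁ + N₂ : ℕ) := by
    rw [Finset.sum_div]
    refine Finset.sum_le_sum fun j hj => ?_
    have hjk : k - j + j = k := Nat.sub_add_cancel (Finset.mem_range_succ_iff.1 hj)
    have := abs_hypergeometric_sub_binomial_le (a := k - j) (b := j) (by omega)
      h₁.1.le h₁.2.le h₂.1.le h₂.2.le hN₁ hN₂
    rwa [hjk] at this
  refine ⟨hcoeff, isHermitian_Dmat .., ?_⟩
  refine (sum_abs_eigenvalues_le _ _ _ _ (Dmat_eq_sum ..)).trans (le_of_eq_of_le ?_ hcoeff)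
  refine Finset.sum_congr rfl fun j hj => ?_
  rw [sum_norm_sq_vkj (Finset.mem_range_succ_iff.1 hj), mul_one]

end
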